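/- arXiv:1811.05203 — 6 statements merged into one kernel-verified Lean document; each statement's English description precedes it below -/
import Mathlib

section
/- Let (G,+) be a finite Abelian group, let ℋ be a set of subgroups of G, and let 𝒲 be a family of channels with input alphabet G such that: (i) if W ∈ 𝒲 then W⁻ ∈ 𝒲 and W⁺ ∈ 𝒲; (ii) there exists δ₀ > 0 such that no channel in 𝒲 is δ₀-determined by a subgroup of G that does not belong to ℋ. Then every channel W ∈ 𝒲 satisfying the background polarization property ℋ-polarizes, i.e., for every δ > 0, lim_{n→∞} 2^{−n}·|{s ∈ {−,+}ⁿ : ∃ H ∈ ℋ such that W^s is δ-determined by H}| = 1. -/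
open scoped Classical

noncomputable section

universe u v

/-- A (discrete memoryless) channel with input alphabet `X` and finite output alphabet `Y`:
nonnegative entries and each row sums to `1`. -/
def IsChannel {X : Type*} {Y : Type*} [Fintype Y] (W : X → Y → ℝ) : Prop :=
  (∀ x y, 0 ≤ W x y) ∧ ∀ x, ∑ y, W x y = 1

/-- The symmetric capacity of a channel: the mutual information between a uniformly
distributed input and the corresponding output (terms with `W x y = 0` vanish). -/
def capacity {X : Type*} {Y : Type*} [Fintype X] [Fintype Y] (W : X → Y → ℝ) : ℝ :=
  ∑ y : Y, ∑ x : X, (1 / (Fintype.card X : ℝ)) * W x y *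
    Real.log (W x y / ((1 / (Fintype.card X : ℝ)) * ∑ x' : X, W x' y))

/-- The quotient channel `W[H] : G ⧸ H → Y`, `W[H](y|A) = (1/|H|) ∑_{x ∈ A} W(y|x)`. -/
def quotientChannel {G : Type*} [AddCommGroup G] [Fintype G] (H : AddSubgroup G)
    {Y : Type*} (W : G → Y → ℝ) : G ⧸ H → Y → ℝ :=
  fun A y => (1 / (Nat.card H : ℝ)) * ∑ x : G, if (x : G ⧸ H) = A then W x y else 0

/-- `W` is `δ`-determined by the subgroup `H`:
`|I(W) − log|G/H|| < δ` and `|I(W[H]) − log|G/H|| < δ`. -/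
def DeterminedBy {G : Type*} [AddCommGroup G] [Fintype G] {Y : Type*} [Fintype Y]
    (W : G → Y → ℝ) (H : AddSubgroup G) (δ : ℝ) : Prop :=
  |capacity W - Real.log (Nat.card (G ⧸ H))| < δ ∧
  |capacity (quotientChannel H W) - Real.log (Nat.card (G ⧸ H))| < δ

/-- The "minus" Arıkan transform `W⁻(y₁,y₂|u₁) = (1/q) ∑_{u₂} W(y₁|u₁+u₂) W(y₂|u₂)`. -/
def minusChannel {G : Type*} [AddCommGroup G] [Fintype G] {Y : Type*}
    (W : G → Y → ℝ) : G → Y × Y → ℝ :=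
  fun u₁ y => (1 / (Fintype.card G : ℝ)) * ∑ u₂ : G, W (u₁ + u₂) y.1 * W u₂ y.2

/-- The "plus" Arıkan transform `W⁺(y₁,y₂,u₁|u₂) = (1/q) W(y₁|u₁+u₂) W(y₂|u₂)`;
the output `(y₁, y₂, u₁)` is encoded as `((y₁, y₂), u₁)`. -/
def plusChannel {G : Type*} [AddCommGroup G] [Fintype G] {Y : Type*}
    (W : G → Y → ℝ) : G → (Y × Y) × G → ℝ :=
  fun u₂ z => (1 / (Fintype.card G : ℝ)) * W (z.2 + u₂) z.1.1 * W u₂ z.1.2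

/-- `W` is degraded from `W'`: `W` is obtained from `W'` by composing with a channel `V`. -/
def DegradedFrom {X : Type*} {Y Y' : Type*} [Fintype Y] [Fintype Y'] (W : X → Y → ℝ)
    (W' : X → Y' → ℝ) : Prop :=
  ∃ V : Y' → Y → ℝ, IsChannel V ∧ ∀ x y, W x y = ∑ y' : Y', W' x y' * V y' y

/-- Channel equivalence: mutual degradation. -/
def EquivalentChannels {X : Type*} {Y Y' : Type*} [Fintype Y] [Fintype Y'] (W : X → Y → ℝ)
    (W' : X → Y' → ℝ) : Prop :=
  DegradedFrom W W' ∧ DegradedFrom W' W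

/-- The erasure channel of input alphabet `A` and parameter `ε`; the output alphabet is
`A ∪ {e}`, modelled as `Option A` with `none` as the erasure symbol `e`. For `A = G` this is
the `q`-ary erasure channel `qEC(ε)`. -/
def erasureChannel (A : Type*) (ε : ℝ) : A → Option A → ℝ :=
  fun x y => match y with
    | some z => if z = x then 1 - ε else 0
    | none => ε

/-- `W : G → Y → ℝ` is a generalized `q`-symmetric channel. -/
def IsGeneralizedSymmetric {G : Type u} [Fintype G] {Y : Type v} [Fintype Y]
    (W : G → Y → ℝ) : Prop :=
  ∃ (Z : Type v) (_ : Fintype Z) (π : G × Z ≃ Y) (p : Z → ℝ) (ε : Z → ℝ),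
    (∀ z, 0 ≤ p z) ∧ (∑ z, p z = 1) ∧
    (∀ z, 0 ≤ ε z) ∧ (∀ z, ε z ≤ 1 / ((Fintype.card G : ℝ) - 1)) ∧
    ∀ x x' z, W x (π (x', z)) =
      if x' = x then p z * (1 - ((Fintype.card G : ℝ) - 1) * ε z) else p z * ε z

/-- `W` is automorphic-symmetric with respect to `(G,+)`: for every automorphism `f` of `G`
there is a bijection `π_f` of the output alphabet with `W(π_f(y)|f(x)) = W(y|x)`. -/
def IsAutSymmetric {G : Type*} [AddCommGroup G] {Y : Type*} (W : G → Y → ℝ) : Prop :=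
  ∀ f : G ≃+ G, ∃ π : Y ≃ Y, ∀ x y, W (f x) (π y) = W x y

/-- A channel with input alphabet `G`, packaged with its (finite) output alphabet. -/
structure Channel (G : Type u) where
  Out : Type u
  [fin : Fintype Out]
  prob : G → Out → ℝ

attribute [instance] Channel.fin

def Channel.minus {G : Type u} [AddCommGroup G] [Fintype G] (C : Channel G) : Channel G :=
  ⟨C.Out × C.Out, minusChannel C.prob⟩

def Channel.plus {G : Type u} [AddCommGroup G] [Fintype G] (C : Channel G) : Channel G :=
  ⟨(C.Out × C.Out) × G, plusChannel C.prob⟩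

/-- `C.polar s` is the synthetic channel `W^s`, where `false` encodes `-`, `true` encodes `+`,
and the head of the list is the first transform applied. -/
def Channel.polar {G : Type u} [AddCommGroup G] [Fintype G] (C : Channel G) :
    List Bool → Channel G
  | [] => C
  | b :: s => (cond b C.plus C.minus).polar s

/-- `C` `𝓗`-polarizes: for every `δ > 0`, the fraction of `s ∈ {−,+}ⁿ` such that `W^s` is
`δ`-determined by some subgroup in `𝓗` tends to `1` as `n → ∞`. Taking `𝓗` to be the set of
all subgroups gives the background (multilevel) polarization property. -/
def Polarizes {G : Type u} [AddCommGroup G] [Fintype G] (C : Channel G)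
    (𝓗 : Set (AddSubgroup G)) : Prop :=
  ∀ δ > (0 : ℝ), Filter.Tendsto
    (fun n : ℕ => ((Finset.univ.filter (fun s : Fin n → Bool =>
        ∃ H ∈ 𝓗, DeterminedBy (C.polar (List.ofFn s)).prob H δ)).card : ℝ) / 2 ^ n)
    Filter.atTop (nhds 1)

theorem DeterminedBy.mono {G : Type*} [AddCommGroup G] [Fintype G] {Y : Type*} [Fintype Y]
    {W : G → Y → ℝ} {H : AddSubgroup G} {δ ε : ℝ} (h : DeterminedBy W H δ) (hle : δ ≤ ε) :
    DeterminedBy W H ε :=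
  ⟨h.1.trans_le hle, h.2.trans_le hle⟩

/-- A family closed under both Arıkan transforms contains all synthetic channels of its members. -/
theorem Channel.polar_mem {G : Type u} [AddCommGroup G] [Fintype G] {𝒲 : Set (Channel G)}
    (hminus : ∀ C ∈ 𝒲, C.minus ∈ 𝒲) (hplus : ∀ C ∈ 𝒲, C.plus ∈ 𝒲) (s : List Bool)
    {C : Channel G} (hC : C ∈ 𝒲) : C.polar s ∈ 𝒲 := by
  induction s generalizing C with
  | nil => exact hC
  | cons b s ih =>
    cases b
    · exact ih (hminus C hC)
    · exact ih (hplus C hC)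

/-- an `ℋ`-polarizing family of channels (closed under the Arıkan transforms,
with no member `δ₀`-determined by a subgroup outside `ℋ`) has all of its members
(that satisfy the background polarization property) `ℋ`-polarize. -/
theorem stmt_0 {G : Type u} [AddCommGroup G] [Fintype G]
    (ℋ : Set (AddSubgroup G)) (𝒲 : Set (Channel G))
    (hchan : ∀ C ∈ 𝒲, IsChannel C.prob)
    (hminus : ∀ C ∈ 𝒲, C.minus ∈ 𝒲) (hplus : ∀ C ∈ 𝒲, C.plus ∈ 𝒲)
    (hdet : ∃ δ₀ > (0 : ℝ), ∀ C ∈ 𝒲, ∀ H : AddSubgroup G, H ∉ ℋ →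
      ¬ DeterminedBy C.prob H δ₀)
    (C : Channel G) (hC : C ∈ 𝒲) (hbg : Polarizes C Set.univ) :
    Polarizes C ℋ := by
  obtain ⟨δ₀, hδ₀, hdet⟩ := hdet
  intro δ hδ
  refine tendsto_of_tendsto_of_tendsto_of_le_of_le (hbg (min δ δ₀) (lt_min hδ hδ₀))
    tendsto_const_nhds (fun n => ?_) (fun n => ?_)
  · dsimp only
    refine div_le_div_of_nonneg_right (Nat.cast_le.2 (Finset.card_le_card
      fun s hs => ?_)) (by positivity)
    obtain ⟨-, H, -, hH⟩ := (@Finset.mem_filter _ _ (_) _ _).1 hs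
    refine Finset.mem_filter.2 ⟨Finset.mem_univ s, H, by_contra fun hmem =>
      hdet _ (Channel.polar_mem hminus hplus _ hC) H hmem (hH.mono (min_le_right _ _)), hH.mono (min_le_left _ _)⟩
  · dsimp only
    rw [div_le_one (by positivity)]
    exact_mod_cast (Finset.card_filter_le _ _).trans (by simp)

end
end

section
/- Let (G,+) be a finite Abelian group with |G| = q, let 0 ≤ ε ≤ 1, and let W : G → 𝒴 be a channel equivalent to qEC(ε). Then W⁺ is equivalent to qEC(ε²). -/
open scoped Classical

noncomputable section

universe u v

theorem sum_ite_eq_add_right {G : Type*} [AddCommGroup G] [Fintype G] (w x : G) (c : ℝ) :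
    (∑ u, if w = u + x then c else 0) = c := by
  rw [Finset.sum_eq_single (w - x)]
  · simp
  · exact fun u _ hu => if_neg fun h => hu (eq_sub_of_add_eq h.symm)
  · simp

theorem DegradedFrom.trans {X Y Y' Y'' : Type*} [Fintype Y] [Fintype Y'] [Fintype Y'']
    {W : X → Y → ℝ} {W' : X → Y' → ℝ} {W'' : X → Y'' → ℝ}
    (h : DegradedFrom W W') (h' : DegradedFrom W' W'') : DegradedFrom W W'' := by
  obtain ⟨V, hV, hVW⟩ := h
  obtain ⟨V', hV', hVW'⟩ := h'
  refine ⟨fun y'' y => ∑ y', V' y'' y' * V y' y, ⟨fun y'' y => ?_, fun y'' => ?_⟩,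
    fun x y => ?_⟩
  · exact Finset.sum_nonneg fun y' _ => mul_nonneg (hV'.1 _ _) (hV.1 _ _)
  · rw [Finset.sum_comm]
    simp_rw [← Finset.mul_sum, hV.2, mul_one]
    exact hV'.2 y''
  · simp_rw [hVW, hVW', Finset.sum_mul, Finset.mul_sum]
    rw [Finset.sum_comm]
    simp_rw [mul_assoc]

theorem EquivalentChannels.trans {X Y Y' Y'' : Type*} [Fintype Y] [Fintype Y'] [Fintype Y'']
    {W : X → Y → ℝ} {W' : X → Y' → ℝ} {W'' : X → Y'' → ℝ}
    (h : EquivalentChannels W W') (h' : EquivalentChannels W' W'') :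
    EquivalentChannels W W'' :=
  ⟨h.1.trans h'.1, h'.2.trans h.2⟩

/-- The plus transform is monotone with respect to degradation. -/
theorem DegradedFrom.plusChannel {G Y Y' : Type*} [AddCommGroup G] [Fintype G] [Fintype Y]
    [Fintype Y'] {W : G → Y → ℝ} {W' : G → Y' → ℝ} (h : DegradedFrom W W') :
    DegradedFrom (plusChannel W) (plusChannel W') := by
  obtain ⟨V, hV, hVW⟩ := h
  refine ⟨fun z' z => V z'.1.1 z.1.1 * V z'.1.2 z.1.2 * if z.2 = z'.2 then 1 else 0,
    ⟨fun z' z => ?_, fun z' => ?_⟩, fun x z => ?_⟩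
  · have h₁ := hV.1 z'.1.1 z.1.1
    have h₂ := hV.1 z'.1.2 z.1.2
    positivity
  · simp [Fintype.sum_prod_type, ← Finset.mul_sum, hV.2]
  · obtain ⟨⟨a, b⟩, u⟩ := z
    simp only [_root_.plusChannel, hVW, Fintype.sum_prod_type, mul_ite, mul_one, mul_zero,
      Finset.sum_ite_eq, Finset.mem_univ, if_true]
    rw [mul_assoc, Finset.sum_mul_sum, Finset.mul_sum]
    refine Finset.sum_congr rfl fun a' _ => ?_
    rw [Finset.mul_sum]
    exact Finset.sum_congr rfl fun b' _ => by ring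

theorem EquivalentChannels.plusChannel {G Y Y' : Type*} [AddCommGroup G] [Fintype G]
    [Fintype Y] [Fintype Y'] {W : G → Y → ℝ} {W' : G → Y' → ℝ}
    (h : EquivalentChannels W W') :
    EquivalentChannels (plusChannel W) (plusChannel W') :=
  ⟨h.1.plusChannel, h.2.plusChannel⟩

/-- The input of a plus-transformed erasure channel can be decoded unless both uses of the
channel are erased. -/
theorem erasureChannel_sq_degradedFrom_plusChannel (G : Type*) [AddCommGroup G] [Fintype G]
    (ε : ℝ) :
    DegradedFrom (erasureChannel G (ε ^ 2)) (plusChannel (erasureChannel G ε)) := by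
  have hq : (Fintype.card G : ℝ) ≠ 0 := by simp
  refine ⟨fun z y => if y = z.1.2.or (z.1.1.map (· - z.2)) then 1 else 0,
    ⟨fun z y => ?_, fun z => by simp⟩, fun x y => ?_⟩
  · positivity
  · cases y with
    | none =>
      simp [plusChannel, erasureChannel, Fintype.sum_prod_type, Fintype.sum_option]
      field_simp
    | some z =>
      have hdecode : ∀ (w : G) (c : ℝ),
          (∑ u, if w - u = z then if w = u + x then c else 0 else 0) =
            if z = x then c else 0 := fun w c => by
        rw [Finset.sum_eq_single (w - x)]
        · simp [eq_comm]
        · intro u _ hu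
          rw [if_neg (c := w = u + x) fun h => hu (eq_sub_of_add_eq h.symm)]
          exact ite_self _
        · simp
      simp [plusChannel, erasureChannel, Fintype.sum_prod_type, Fintype.sum_option, hdecode,
        sum_ite_eq_add_right]
      split_ifs
      · field_simp
        ring
      · simp

/-- The outputs of a plus-transformed erasure channel can be simulated from a single use of
the erasure channel with squared parameter: conditionally on an unerased input, the
probabilities of the three patterns with at least one unerased output have the common
denominator `1 + ε`. -/
theorem plusChannel_erasureChannel_degradedFrom (G : Type*) [AddCommGroup G] [Fintype G]
    {ε : ℝ} (hε0 : 0 ≤ ε) (hε1 : ε ≤ 1) :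
    DegradedFrom (plusChannel (erasureChannel G ε)) (erasureChannel G (ε ^ 2)) := by
  have hq : (Fintype.card G : ℝ) ≠ 0 := by simp
  have hε : 1 + ε ≠ 0 := by positivity
  have hε1' : 0 ≤ 1 - ε := by linarith
  let V : Option G → (Option G × Option G) × G → ℝ
    | none, ((none, none), _) => 1 / Fintype.card G
    | some x, ((some a, some b), u) =>
      if a = u + x ∧ b = x then (1 - ε) / (1 + ε) / Fintype.card G else 0
    | some x, ((some a, none), u) => if a = u + x then ε / (1 + ε) / Fintype.card G else 0
    | some x, ((none, some b), _) => if b = x then ε / (1 + ε) / Fintype.card G else 0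
    | _, _ => 0
  refine ⟨V, ⟨?_, ?_⟩, ?_⟩
  · rintro (_ | x) ⟨⟨_ | a, _ | b⟩, u⟩ <;> simp only [V] <;> positivity
  · rintro (_ | x)
    · simp [V, Fintype.sum_prod_type, Fintype.sum_option]
    · simp [V, Fintype.sum_prod_type, Fintype.sum_option, ite_and,
        sum_ite_eq_add_right]
      field_simp
      ring
  · rintro x ⟨⟨_ | a, _ | b⟩, u⟩
    · simp [plusChannel, erasureChannel, V, Fintype.sum_option]
      ring
    · simp [plusChannel, erasureChannel, V, Fintype.sum_option]
      congr 1
      field_simp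
      ring
    · simp [plusChannel, erasureChannel, V, Fintype.sum_option]
      rw [Finset.sum_eq_single x (by simp +contextual) (by simp), if_pos rfl]
      congr 1
      field_simp
      ring
    · simp [plusChannel, erasureChannel, V, Fintype.sum_option]
      rw [Finset.sum_eq_single x (by simp +contextual) (by simp), if_pos rfl]
      simp only [and_comm (a := a = u + x), ite_and]
      congr 2
      field_simp
      ring

/-- if `W` is equivalent to `qEC(ε)`, then `W⁺` is equivalent to `qEC(ε²)`. -/
theorem stmt_2 {G : Type*} [AddCommGroup G] [Fintype G] {Y : Type*} [Fintype Y]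
    (ε : ℝ) (hε0 : 0 ≤ ε) (hε1 : ε ≤ 1) (W : G → Y → ℝ) (hW : IsChannel W)
    (hequiv : EquivalentChannels W (erasureChannel G ε)) :
    EquivalentChannels (plusChannel W) (erasureChannel G (ε ^ 2)) :=
  hequiv.plusChannel.trans ⟨plusChannel_erasureChannel_degradedFrom G hε0 hε1,
    erasureChannel_sq_degradedFrom_plusChannel G ε⟩

end
end

section
/- Let (G,+) be a finite Abelian group with |G| = q ≥ 2 and set δ_qEC = (log 2)² / log(2q). If W : G → 𝒴 is a channel equivalent to qEC(ε) for some 0 ≤ ε ≤ 1, then there is no subgroup H of G with H ≠ {0} and H ≠ G such that W is δ_qEC-determined by H. -/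
open scoped Classical

noncomputable section

universe u v

/-- Data processing inequality: degrading a channel does not increase its symmetric capacity. -/
theorem capacity_le_of_degradedFrom {X Y Y' : Type*} [Fintype X] [Fintype Y] [Fintype Y']
    {W : X → Y → ℝ} {W' : X → Y' → ℝ} (hW' : ∀ x y, 0 ≤ W' x y) (h : DegradedFrom W W') :
    capacity W ≤ capacity W' := by
  obtain ⟨V, ⟨hV0, hV1⟩, hWV⟩ := h
  have hW : ∀ x y, 0 ≤ W x y := fun x y => by
    rw [hWV]
    exact Finset.sum_nonneg fun y' _ => mul_nonneg (hW' x y') (hV0 y' y)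
  rcases isEmpty_or_nonempty X with hX | hX
  · simp [capacity]
  set c : ℝ := 1 / (Fintype.card X : ℝ) with hc
  have hcpos : 0 < c := by positivity
  set P : Y → ℝ := fun y => c * ∑ x', W x' y with hP
  set P' : Y' → ℝ := fun y' => c * ∑ x', W' x' y' with hP'
  have le_P : ∀ x y, c * W x y ≤ P y := fun x y =>
    mul_le_mul_of_nonneg_left
      (Finset.single_le_sum (f := fun x' => W x' y) (fun x' _ => hW x' y) (Finset.mem_univ x))
      hcpos.le
  have le_P' : ∀ x y', c * W' x y' ≤ P' y' := fun x y' =>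
    mul_le_mul_of_nonneg_left
      (Finset.single_le_sum (f := fun x' => W' x' y') (fun x' _ => hW' x' y')
        (Finset.mem_univ x)) hcpos.le
  have hPV : ∀ y, P y = ∑ y', P' y' * V y' y := fun y => by
    simp only [hP, hP', hWV]
    rw [Finset.sum_comm, Finset.mul_sum]
    refine Finset.sum_congr rfl fun y' _ => ?_
    rw [mul_assoc, Finset.sum_mul]
  have hP0 : ∀ y, 0 ≤ P y := fun y =>
    mul_nonneg hcpos.le (Finset.sum_nonneg fun x _ => hW x y)
  have hP'0 : ∀ y', 0 ≤ P' y' := fun y' =>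
    mul_nonneg hcpos.le (Finset.sum_nonneg fun x _ => hW' x y')
  have termwise : ∀ x y y', W' x y' * V y' y * Real.log (W x y / P y) ≤
      W' x y' * V y' y * Real.log (W' x y' / P' y') - W' x y' * V y' y
        + P' y' * V y' y * (W x y / P y) := by
    intro x y y'
    have hR : 0 ≤ P' y' * V y' y * (W x y / P y) :=
      mul_nonneg (mul_nonneg (hP'0 y') (hV0 y' y)) (div_nonneg (hW x y) (hP0 y))
    rcases (mul_nonneg (hW' x y') (hV0 y' y)).eq_or_lt with h0 | hpos
    · rw [← h0]
      linarith
    have ha : 0 < W' x y' := (hW' x y').lt_of_ne fun h => by simp [← h] at hpos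
    have hA : 0 < W x y := by
      rw [hWV]
      exact hpos.trans_le (Finset.single_le_sum (f := fun y' => W' x y' * V y' y)
        (fun z _ => mul_nonneg (hW' x z) (hV0 z y)) (Finset.mem_univ y'))
    have hp : 0 < P' y' := (mul_pos hcpos ha).trans_le (le_P' x y')
    have hPy : 0 < P y := (mul_pos hcpos hA).trans_le (le_P x y)
    have hlog := Real.log_le_sub_one_of_pos
      (div_pos (div_pos hA hPy) (div_pos ha hp))
    rw [Real.log_div (div_pos hA hPy).ne' (div_pos ha hp).ne'] at hlog
    have hmul := mul_le_mul_of_nonneg_left hlog hpos.le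
    have e : W' x y' * V y' y * (W x y / P y / (W' x y' / P' y') - 1) =
        P' y' * V y' y * (W x y / P y) - W' x y' * V y' y := by
      field_simp
    rw [e] at hmul
    linarith
  have rowwise : ∀ x y, W x y * Real.log (W x y / P y) ≤
      ∑ y', W' x y' * V y' y * Real.log (W' x y' / P' y') := by
    intro x y
    have hs := Finset.sum_le_sum fun y' (_ : y' ∈ Finset.univ) => termwise x y y'
    rw [← Finset.sum_mul, Finset.sum_add_distrib, Finset.sum_sub_distrib, ← Finset.sum_mul,
      ← hWV, ← hPV] at hs
    have hcancel : P y * (W x y / P y) = W x y := by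
      rcases (hP0 y).eq_or_lt with h0 | hpos
      · have := le_P x y
        rw [← h0] at this
        rw [← h0, zero_mul]
        nlinarith [hW x y]
      · field_simp
    linarith
  calc capacity W = ∑ x, c * ∑ y, W x y * Real.log (W x y / P y) := by
        simp only [capacity, ← hc, hP]
        rw [Finset.sum_comm]
        simp only [Finset.mul_sum, mul_assoc]
    _ ≤ ∑ x, c * ∑ y, ∑ y', W' x y' * V y' y * Real.log (W' x y' / P' y') :=
        Finset.sum_le_sum fun x _ => mul_le_mul_of_nonneg_left
          (Finset.sum_le_sum fun y _ => rowwise x y) hcpos.le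
    _ = ∑ x, c * ∑ y', W' x y' * Real.log (W' x y' / P' y') := by
        refine Finset.sum_congr rfl fun x _ => ?_
        rw [Finset.sum_comm]
        congr 1
        refine Finset.sum_congr rfl fun y' _ => ?_
        rw [← Finset.sum_mul, ← Finset.mul_sum, hV1, mul_one]
    _ = capacity W' := by
        simp only [capacity, ← hc, hP']
        rw [Finset.sum_comm]
        simp only [Finset.mul_sum, mul_assoc]

theorem erasureChannel_nonneg {A : Type*} {ε : ℝ} (hε0 : 0 ≤ ε) (hε1 : ε ≤ 1)
    (x : A) (y : Option A) : 0 ≤ erasureChannel A ε x y := by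
  cases y with
  | none => exact hε0
  | some z =>
    simp only [erasureChannel]
    split_ifs <;> linarith

theorem capacity_erasureChannel {A : Type*} [Fintype A] [Nonempty A] (ε : ℝ) :
    capacity (erasureChannel A ε) = (1 - ε) * Real.log (Fintype.card A) := by
  have hq : (Fintype.card A : ℝ) ≠ 0 := by positivity
  rw [capacity, Fintype.sum_option]
  have hnone : ∑ x : A, (1 / (Fintype.card A : ℝ)) * erasureChannel A ε x none *
      Real.log (erasureChannel A ε x none /
        ((1 / (Fintype.card A : ℝ)) * ∑ x' : A, erasureChannel A ε x' none)) = 0 := by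
    refine Finset.sum_eq_zero fun x _ => ?_
    rcases eq_or_ne ε 0 with h | h
    · simp [erasureChannel, h]
    · simp [erasureChannel, h, hq]
  have hsome : ∀ z : A, ∑ x : A, (1 / (Fintype.card A : ℝ)) * erasureChannel A ε x (some z) *
      Real.log (erasureChannel A ε x (some z) /
        ((1 / (Fintype.card A : ℝ)) * ∑ x' : A, erasureChannel A ε x' (some z))) =
      (1 / (Fintype.card A : ℝ)) * ((1 - ε) * Real.log (Fintype.card A)) := by
    intro z
    rw [Finset.sum_eq_single z (fun x _ hx => by simp [erasureChannel, hx.symm]) (by simp)]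
    rcases eq_or_ne (1 - ε) 0 with h | h
    · simp [erasureChannel, h]
    · have : (1 - ε) / (1 / (Fintype.card A : ℝ) * (1 - ε)) = Fintype.card A := by
        field_simp
      simp only [erasureChannel, Finset.sum_ite_eq, Finset.mem_univ, if_true, this]
      ring
  rw [hnone, Finset.sum_congr rfl fun z _ => hsome z]
  simp [hq]

theorem sum_ite_mk_eq {G : Type*} [AddCommGroup G] [Fintype G] (H : AddSubgroup G) (A : G ⧸ H) :
    (∑ x : G, if (x : G ⧸ H) = A then (1 : ℝ) else 0) = Nat.card H := by
  induction A using QuotientAddGroup.induction_on with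
  | H a =>
    rw [← Equiv.sum_comp (Equiv.addLeft a)]
    simp [Nat.card_eq_fintype_card, Fintype.card_subtype]

theorem IsChannel.quotientChannel {G : Type*} [AddCommGroup G] [Fintype G] (H : AddSubgroup G)
    {Y : Type*} [Fintype Y] {W : G → Y → ℝ} (hW : IsChannel W) :
    IsChannel (quotientChannel H W) := by
  refine ⟨fun A y => mul_nonneg (by positivity) (Finset.sum_nonneg fun x _ => ?_), fun A => ?_⟩
  · split_ifs
    · exact hW.1 x y
    · exact le_rfl
  · have hH : (Nat.card H : ℝ) ≠ 0 := by exact_mod_cast Nat.card_pos.ne'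
    simp only [_root_.quotientChannel]
    rw [← Finset.mul_sum, Finset.sum_comm]
    have : ∀ x : G, (∑ y, if (x : G ⧸ H) = A then W x y else 0) =
        if (x : G ⧸ H) = A then 1 else 0 := fun x => by
      split_ifs
      · exact hW.2 x
      · simp
    simp only [this, sum_ite_mk_eq]
    field_simp

/-- Quotients of channels degraded from an erasure channel on `G` are degraded from the erasure
channel on `G ⧸ H` with the same erasure probability. -/
theorem DegradedFrom.quotientChannel_erasureChannel {G : Type*} [AddCommGroup G] [Fintype G]
    (H : AddSubgroup G) {Y : Type*} [Fintype Y] {W : G → Y → ℝ} {ε : ℝ}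
    (h : DegradedFrom W (erasureChannel G ε)) :
    DegradedFrom (quotientChannel H W) (erasureChannel (G ⧸ H) ε) := by
  obtain ⟨V, hV, hWV⟩ := h
  have hQ : IsChannel (quotientChannel H fun x => V (some x)) :=
    IsChannel.quotientChannel H ⟨fun x => hV.1 _, fun x => hV.2 _⟩
  refine ⟨fun o => o.elim (V none) (quotientChannel H fun x => V (some x)), ⟨?_, ?_⟩, ?_⟩
  · rintro (_ | A) y
    · exact hV.1 _ _
    · exact hQ.1 _ _
  · rintro (_ | A)
    · exact hV.2 _
    · exact hQ.2 _
  · intro A y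
    have hW : ∀ x, W x y = ε * V none y + (1 - ε) * V (some x) y := fun x => by
      rw [hWV, Fintype.sum_option]
      simp [erasureChannel]
    have hH : (Nat.card H : ℝ) ≠ 0 := by exact_mod_cast Nat.card_pos.ne'
    have hsum : (∑ x : G, if (x : G ⧸ H) = A then W x y else 0) =
        ε * V none y * Nat.card H +
          (1 - ε) * ∑ x : G, if (x : G ⧸ H) = A then V (some x) y else 0 := by
      rw [← sum_ite_mk_eq H A, Finset.mul_sum, Finset.mul_sum, ← Finset.sum_add_distrib]
      refine Finset.sum_congr rfl fun x _ => ?_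
      split_ifs <;> simp [hW]
    rw [Fintype.sum_option]
    simp only [erasureChannel, ite_mul, zero_mul, Finset.sum_ite_eq',
      Finset.mem_univ, if_true, Option.elim]
    simp only [quotientChannel, hsum]
    field_simp

/-- with `δ_qEC = (log 2)² / log(2q)`, no channel equivalent to a `q`-ary
erasure channel is `δ_qEC`-determined by a non-trivial subgroup. -/
theorem stmt_5 {G : Type*} [AddCommGroup G] [Fintype G] {Y : Type*} [Fintype Y]
    (hq : 2 ≤ Fintype.card G) (W : G → Y → ℝ) (hW : IsChannel W)
    (ε : ℝ) (hε0 : 0 ≤ ε) (hε1 : ε ≤ 1)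
    (hequiv : EquivalentChannels W (erasureChannel G ε))
    (H : AddSubgroup G) (hbot : H ≠ ⊥) (htop : H ≠ ⊤) :
    ¬ DeterminedBy W H ((Real.log 2) ^ 2 / Real.log (2 * (Fintype.card G : ℝ))) := by
  rintro ⟨h₁, h₂⟩
  obtain ⟨hdeg, hdeg'⟩ := hequiv
  have hle : capacity (erasureChannel G ε) ≤ capacity W :=
    capacity_le_of_degradedFrom hW.1 hdeg'
  have hle' : capacity (quotientChannel H W) ≤ capacity (erasureChannel (G ⧸ H) ε) :=
    capacity_le_of_degradedFrom (erasureChannel_nonneg hε0 hε1)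
      (hdeg.quotientChannel_erasureChannel H)
  rw [capacity_erasureChannel] at hle hle'
  rw [← Nat.card_eq_fintype_card] at hle hle'
  rw [← Nat.card_eq_fintype_card] at h₁ h₂
  have hm : 2 ≤ Nat.card (G ⧸ H) := by
    have h1 : H.index ≠ 1 := fun h => htop (AddSubgroup.index_eq_one.mp h)
    have h0 : 0 < Nat.card (G ⧸ H) := Nat.card_pos
    have h2 : Nat.card (G ⧸ H) ≠ 1 := h1
    omega
  have hh : 2 ≤ Nat.card H := (AddSubgroup.one_lt_card_iff_ne_bot H).mpr hbot
  have hcard : (Nat.card G : ℝ) = Nat.card (G ⧸ H) * Nat.card H := by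
    exact_mod_cast AddSubgroup.card_eq_card_quotient_mul_card_addSubgroup H
  have hm' : (2 : ℝ) ≤ Nat.card (G ⧸ H) := by exact_mod_cast hm
  have hh' : (2 : ℝ) ≤ Nat.card H := by exact_mod_cast hh
  rw [hcard] at h₁ h₂ hle
  rw [Real.log_mul (by positivity) (by positivity), Real.log_mul (by positivity) (by positivity)]
    at h₁ h₂
  rw [Real.log_mul (by positivity) (by positivity)] at hle
  have hl : 0 < Real.log 2 := Real.log_pos one_lt_two
  have ha := Real.log_le_log two_pos hm'
  have hb := Real.log_le_log two_pos hh'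
  set l := Real.log 2
  set a := Real.log (Nat.card (G ⧸ H))
  set b := Real.log (Nat.card H)
  set δ := l ^ 2 / (l + (a + b)) with hδ
  have hb₁ : b - ε * (a + b) < δ := by linarith [(abs_lt.mp h₁).2]
  have ha₁ : ε * a < δ := by linarith [(abs_lt.mp h₂).1]
  have hδeq : δ * (l + (a + b)) = l ^ 2 := by
    have hpos : l + (a + b) ≠ 0 := ne_of_gt (by linarith)
    rw [hδ, div_mul_cancel₀ _ hpos]
  have hlt : a * b < δ * (2 * a + b) := by nlinarith
  have hlt' : a * b * (l + (a + b)) < l ^ 2 * (2 * a + b) := by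
    rw [← hδeq]
    nlinarith
  have hab : l * a ≤ a * b := by nlinarith
  have hla : l * l ≤ l * a := by nlinarith
  have hlb : l * b ≤ a * b := by nlinarith
  have h3 : l ^ 2 * a ≤ a * b * l := by nlinarith
  have h4 : l ^ 2 * a ≤ a * b * a := by nlinarith
  have h5 : l ^ 2 * b ≤ a * b * b := by nlinarith
  linarith

end
end

section
/- Let (G,+) be a finite Abelian group with |G| = q. If the channel W : G → 𝒴 is automorphic-symmetric with respect to (G,+), then W⁻ : G → 𝒴² is automorphic-symmetric with respect to (G,+). -/
open scoped Classical

noncomputable section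

universe u v

/-- if `W` is automorphic-symmetric, then so is `W⁻`. -/
theorem stmt_8 {G : Type*} [AddCommGroup G] [Fintype G] {Y : Type*} [Fintype Y]
    (W : G → Y → ℝ) (hW : IsChannel W) (hsym : IsAutSymmetric W) :
    IsAutSymmetric (minusChannel W) := by
  intro f
  obtain ⟨π, hπ⟩ := hsym f
  refine ⟨π.prodCongr π, fun x y => ?_⟩
  simp only [minusChannel, Equiv.prodCongr_apply, Prod.map_fst, Prod.map_snd]
  congr 1
  refine (Fintype.sum_equiv f.toEquiv _ _ fun u => ?_).symm
  simp [← map_add, hπ]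

end
end

section
/- Let (G,+) be a finite Abelian group with |G| = q. If the channel W : G → 𝒴 is automorphic-symmetric with respect to (G,+), then W⁺ : G → 𝒴²×G is automorphic-symmetric with respect to (G,+). -/
open scoped Classical

noncomputable section

universe u v

/-- if `W` is automorphic-symmetric, then so is `W⁺`. -/
theorem stmt_9 {G : Type*} [AddCommGroup G] [Fintype G] {Y : Type*} [Fintype Y]
    (W : G → Y → ℝ) (hW : IsChannel W) (hsym : IsAutSymmetric W) :
    IsAutSymmetric (plusChannel W) := by
  intro f
  obtain ⟨π, hπ⟩ := hsym f
  refine ⟨(π.prodCongr π).prodCongr f.toEquiv, ?_⟩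
  rintro u₂ ⟨⟨y₁, y₂⟩, u₁⟩
  change (1 / (Fintype.card G : ℝ)) * W (f u₁ + f u₂) (π y₁) * W (f u₂) (π y₂) =
    (1 / (Fintype.card G : ℝ)) * W (u₁ + u₂) y₁ * W u₂ y₂
  rw [← map_add, hπ, hπ]

end
end

section
/- Let (G,+) be a finite Abelian group with |G| = q and set δ₀ = (log 2)/3. For every channel W : G → 𝒴 and all subgroups H₁, H₂ of G, if W is δ₀-determined by H₁ and W is δ₀-determined by H₂, then H₁ = H₂. In other words, a channel is δ₀-determined by at most one subgroup of G. -/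
open scoped Classical

noncomputable section

universe u v

/-- The sum of `f` over the coset of `H` containing `x`. -/
def cosetSum {G : Type*} [AddCommGroup G] [Fintype G] (H : AddSubgroup G) (f : G → ℝ)
    (x : G) : ℝ :=
  ∑ x' : G, if (x' : G ⧸ H) = x then f x' else 0

section CosetSum

variable {G : Type*} [AddCommGroup G] [Fintype G] {f : G → ℝ}

lemma cosetSum_nonneg (hf : ∀ x, 0 ≤ f x) (H : AddSubgroup G) (x : G) : 0 ≤ cosetSum H f x :=
  Finset.sum_nonneg fun a _ => by split_ifs <;> simp [hf]

lemma le_cosetSum (hf : ∀ x, 0 ≤ f x) (H : AddSubgroup G) (x : G) : f x ≤ cosetSum H f x := by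
  have := Finset.single_le_sum
    (f := fun x' : G => if (x' : G ⧸ H) = x then f x' else 0)
    (fun a _ => by split_ifs <;> simp [hf]) (Finset.mem_univ x)
  simpa [cosetSum] using this

/-- Two cosets of `H₁` and `H₂` meet in at most `|H₁ ⊓ H₂|` points. -/
lemma card_inter_cosets_le (H₁ H₂ : AddSubgroup G) (a b : G) :
    (Finset.univ.filter fun x : G => (a : G ⧸ H₁) = x ∧ (b : G ⧸ H₂) = x).card
      ≤ Nat.card (H₁ ⊓ H₂ : AddSubgroup G) := by
  set s := Finset.univ.filter fun x : G => (a : G ⧸ H₁) = x ∧ (b : G ⧸ H₂) = x with hs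
  rcases s.eq_empty_or_nonempty with h | ⟨x₀, hx₀⟩
  · simp [h]
  · rw [← Nat.card_eq_finsetCard]
    have hmem : ∀ x : s, -x₀ + x.1 ∈ H₁ ⊓ H₂ := by
      rintro ⟨x, hx⟩
      simp only [hs, Finset.mem_univ, true_and, Finset.mem_filter] at hx hx₀
      exact ⟨QuotientAddGroup.eq.1 (hx₀.1.symm.trans hx.1),
        QuotientAddGroup.eq.1 (hx₀.2.symm.trans hx.2)⟩
    refine Nat.card_le_card_of_injective (fun x => ⟨-x₀ + x.1, hmem x⟩) fun x y hxy => ?_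
    exact Subtype.ext (add_left_cancel (Subtype.ext_iff.1 hxy))

lemma sum_cosetSum_mul_cosetSum_le (hf : ∀ x, 0 ≤ f x) (H₁ H₂ : AddSubgroup G) :
    ∑ x, cosetSum H₁ f x * cosetSum H₂ f x
      ≤ Nat.card (H₁ ⊓ H₂ : AddSubgroup G) * (∑ x, f x) ^ 2 := by
  calc ∑ x, cosetSum H₁ f x * cosetSum H₂ f x
      = ∑ a, ∑ b, (f a * f b) *
          (Finset.univ.filter fun x : G => (a : G ⧸ H₁) = x ∧ (b : G ⧸ H₂) = x).card := by
        simp only [cosetSum, Finset.sum_mul_sum]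
        rw [Finset.sum_comm]
        refine Finset.sum_congr rfl fun a _ => ?_
        rw [Finset.sum_comm]
        refine Finset.sum_congr rfl fun b _ => ?_
        rw [Finset.card_filter, Nat.cast_sum, Finset.mul_sum]
        refine Finset.sum_congr rfl fun x _ => ?_
        by_cases h₁ : (a : G ⧸ H₁) = x <;> by_cases h₂ : (b : G ⧸ H₂) = x <;> simp [h₁, h₂]
    _ ≤ ∑ a, ∑ b, (f a * f b) * Nat.card (H₁ ⊓ H₂ : AddSubgroup G) := by
        gcongr with a _ b _
        · exact mul_nonneg (hf a) (hf b)
        · exact card_inter_cosets_le H₁ H₂ a b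
    _ = Nat.card (H₁ ⊓ H₂ : AddSubgroup G) * (∑ x, f x) ^ 2 := by
        simp_rw [← Finset.sum_mul]
        rw [sq, Finset.sum_mul_sum, mul_comm]

/-- Unnormalized form of the nonnegativity of a relative entropy. -/
lemma sum_mul_log_cosetSum_nonneg (hf : ∀ x, 0 ≤ f x) (H₁ H₂ : AddSubgroup G) :
    0 ≤ ∑ x, f x * Real.log (f x * (∑ x', f x') * Nat.card (H₁ ⊓ H₂ : AddSubgroup G) /
      (cosetSum H₁ f x * cosetSum H₂ f x)) := by
  set S := ∑ x', f x' with hS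
  set k : ℝ := (Nat.card (H₁ ⊓ H₂ : AddSubgroup G) : ℝ) with hk
  have hk0 : 0 < k := by rw [hk]; exact_mod_cast Nat.card_pos
  rcases (Finset.sum_nonneg fun x _ => hf x : 0 ≤ S).eq_or_lt with h0 | hpos
  · have hz : ∀ x, f x = 0 := fun x =>
      (Finset.sum_eq_zero_iff_of_nonneg fun x _ => hf x).1 h0.symm x (Finset.mem_univ x)
    simp [hz]
  have hterm : ∀ x, f x - cosetSum H₁ f x * cosetSum H₂ f x / (S * k) ≤
      f x * Real.log (f x * S * k / (cosetSum H₁ f x * cosetSum H₂ f x)) := by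
    intro x
    have c₁ := cosetSum_nonneg hf H₁ x
    have c₂ := cosetSum_nonneg hf H₂ x
    rcases (hf x).eq_or_lt with hx | hx
    · rw [← hx]
      have : 0 ≤ cosetSum H₁ f x * cosetSum H₂ f x / (S * k) := by positivity
      linarith
    · have p₁ := hx.trans_le (le_cosetSum hf H₁ x)
      have p₂ := hx.trans_le (le_cosetSum hf H₂ x)
      have hl := Real.one_sub_inv_le_log_of_pos
        (x := f x * S * k / (cosetSum H₁ f x * cosetSum H₂ f x)) (by positivity)
      refine le_trans (le_of_eq ?_) (mul_le_mul_of_nonneg_left hl hx.le)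
      field_simp
  refine le_trans ?_ (Finset.sum_le_sum fun x _ => hterm x)
  rw [Finset.sum_sub_distrib, ← Finset.sum_div, ← hS, sub_nonneg, div_le_iff₀ (by positivity)]
  calc _ ≤ k * S ^ 2 := sum_cosetSum_mul_cosetSum_le hf H₁ H₂
    _ = S * (S * k) := by ring

end CosetSum

section Capacity

variable {G : Type*} [AddCommGroup G] [Fintype G] {Y : Type*} [Fintype Y] {W : G → Y → ℝ}

lemma capacity_quotientChannel (W : G → Y → ℝ) (H : AddSubgroup G) :
    capacity (quotientChannel H W) = ∑ y, ∑ x, (1 / (Fintype.card G : ℝ)) * W x y *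
      Real.log (Nat.card (G ⧸ H) * cosetSum H (fun x => W x y) x / ∑ x', W x' y) := by
  have hcard : (Fintype.card G : ℝ) = Fintype.card (G ⧸ H) * Nat.card H := by
    have := AddSubgroup.card_eq_card_quotient_mul_card_addSubgroup H
    rw [Nat.card_eq_fintype_card, Nat.card_eq_fintype_card (α := G ⧸ H)] at this
    exact_mod_cast this
  have hH : (Nat.card H : ℝ) ≠ 0 := by exact_mod_cast Nat.card_pos.ne'
  have hn : (Fintype.card (G ⧸ H) : ℝ) ≠ 0 := by exact_mod_cast Fintype.card_pos.ne'
  unfold capacity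
  refine Finset.sum_congr rfl fun y _ => ?_
  have htot : ∑ A, quotientChannel H W A y = (1 / (Nat.card H : ℝ)) * ∑ x, W x y := by
    simp only [quotientChannel]
    rw [← Finset.mul_sum, Finset.sum_comm]
    simp
  rw [htot]
  have hexp : ∀ A : G ⧸ H, (1 / (Fintype.card (G ⧸ H) : ℝ)) * quotientChannel H W A y *
      Real.log (quotientChannel H W A y /
        (1 / (Fintype.card (G ⧸ H) : ℝ) * (1 / (Nat.card H : ℝ) * ∑ x, W x y))) =
      ∑ x : G, if (x : G ⧸ H) = A then (1 / (Fintype.card G : ℝ)) * W x y *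
        Real.log (Nat.card (G ⧸ H) * cosetSum H (fun x => W x y) x / ∑ x', W x' y) else 0 := by
    intro A
    have : ∀ x : G, (if (x : G ⧸ H) = A then (1 / (Fintype.card G : ℝ)) * W x y *
        Real.log (Nat.card (G ⧸ H) * cosetSum H (fun x => W x y) x / ∑ x', W x' y) else 0) =
        (1 / (Fintype.card G : ℝ)) * (if (x : G ⧸ H) = A then W x y else 0) *
        Real.log (quotientChannel H W A y /
        (1 / (Fintype.card (G ⧸ H) : ℝ) * (1 / (Nat.card H : ℝ) * ∑ x, W x y))) := by
      intro x
      split_ifs with h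
      · subst h
        congr 2
        rw [Nat.card_eq_fintype_card]
        simp only [quotientChannel, cosetSum]
        field_simp
      · simp
    simp_rw [this]
    rw [← Finset.sum_mul, ← Finset.mul_sum, hcard]
    simp only [quotientChannel]
    congr 1
    field_simp
  simp_rw [hexp]
  rw [Finset.sum_comm]
  simp

/-- Subadditivity of conditional entropy together with data processing: if
`H(X mod H | Y) = log |G ⧸ H| - I(W[H])`, then `X mod H₁ ⊓ H₂` is determined by its two
projections. -/
lemma capacity_quotientChannel_add_le (hW : IsChannel W) (H₁ H₂ : AddSubgroup G) :
    capacity (quotientChannel H₁ W) + capacity (quotientChannel H₂ W) +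
        Real.log (Nat.card (G ⧸ (H₁ ⊓ H₂))) ≤
      capacity W + Real.log (Nat.card (G ⧸ H₁)) + Real.log (Nat.card (G ⧸ H₂)) := by
  have hcard : (Fintype.card G : ℝ) =
      Nat.card (G ⧸ (H₁ ⊓ H₂)) * Nat.card (H₁ ⊓ H₂ : AddSubgroup G) := by
    have := AddSubgroup.card_eq_card_quotient_mul_card_addSubgroup (H₁ ⊓ H₂)
    rw [Nat.card_eq_fintype_card (α := G)] at this
    exact_mod_cast this
  have hq : 0 < (Fintype.card G : ℝ) := by exact_mod_cast Fintype.card_pos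
  have hn : ∀ H : AddSubgroup G, 0 < (Nat.card (G ⧸ H) : ℝ) := fun H => by
    exact_mod_cast Nat.card_pos
  have hk : 0 < (Nat.card (H₁ ⊓ H₂ : AddSubgroup G) : ℝ) := by exact_mod_cast Nat.card_pos
  have htot : ∀ c : ℝ, c = ∑ y, ∑ x, (1 / (Fintype.card G : ℝ)) * W x y * c := by
    intro c
    simp_rw [← Finset.sum_mul, ← Finset.mul_sum]
    rw [Finset.sum_comm]
    simp_rw [hW.2]
    simp [hq.ne']
  have key : 0 ≤ ∑ y, (1 / (Fintype.card G : ℝ)) * ∑ x, W x y * Real.log (W x y *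
      (∑ x', W x' y) * Nat.card (H₁ ⊓ H₂ : AddSubgroup G) /
      (cosetSum H₁ (fun x => W x y) x * cosetSum H₂ (fun x => W x y) x)) :=
    Finset.sum_nonneg fun y _ => mul_nonneg (by positivity)
      (sum_mul_log_cosetSum_nonneg (fun x => hW.1 x y) H₁ H₂)
  rw [← sub_nonneg]
  refine key.trans_eq ?_
  rw [capacity_quotientChannel, capacity_quotientChannel, capacity,
    htot (Real.log (Nat.card (G ⧸ (H₁ ⊓ H₂)))), htot (Real.log (Nat.card (G ⧸ H₁))),
    htot (Real.log (Nat.card (G ⧸ H₂)))]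
  simp_rw [← Finset.sum_add_distrib, ← Finset.sum_sub_distrib]
  refine Finset.sum_congr rfl fun y _ => ?_
  rw [Finset.mul_sum]
  refine Finset.sum_congr rfl fun x _ => ?_
  rcases (hW.1 x y).eq_or_lt with hx | hx
  · simp [← hx]
  have hf : ∀ x, 0 ≤ W x y := fun x => hW.1 x y
  have hS : 0 < ∑ x', W x' y :=
    hx.trans_le (Finset.single_le_sum (fun a _ => hf a) (Finset.mem_univ x))
  have p₁ := hx.trans_le (le_cosetSum hf H₁ x)
  have p₂ := hx.trans_le (le_cosetSum hf H₂ x)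
  have n₁ := hn H₁
  have n₂ := hn H₂
  have n₃ := hn (H₁ ⊓ H₂)
  rw [hcard, Real.log_div (by positivity) (by positivity), Real.log_div (by positivity) (by positivity),
    Real.log_div (by positivity) (by positivity), Real.log_div (by positivity) (by positivity),
    Real.log_mul (by positivity) (by positivity), Real.log_mul (by positivity) (by positivity),
    Real.log_mul (by positivity) (by positivity), Real.log_mul (by positivity) (by positivity),
    Real.log_mul (by positivity) (by positivity), Real.log_mul (by positivity) (by positivity),
    Real.log_div (by positivity) (by positivity), Real.log_mul (by positivity) (by positivity)]
  simp only [Real.log_one]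
  ring

lemma le_of_determinedBy (hW : IsChannel W) {H₁ H₂ : AddSubgroup G}
    (h₁ : DeterminedBy W H₁ (Real.log 2 / 3)) (h₂ : DeterminedBy W H₂ (Real.log 2 / 3)) :
    H₁ ≤ H₂ := by
  have hle := capacity_quotientChannel_add_le hW H₁ H₂
  have a := (abs_lt.1 h₁.1).2
  have b := (abs_lt.1 h₁.2).1
  have c := (abs_lt.1 h₂.2).1
  have n₁ : 0 < (Nat.card (G ⧸ H₁) : ℝ) := by exact_mod_cast Nat.card_pos
  have n₂ : 0 < (Nat.card (G ⧸ (H₁ ⊓ H₂)) : ℝ) := by exact_mod_cast Nat.card_pos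
  have hlog : Real.log (Nat.card (G ⧸ (H₁ ⊓ H₂))) < Real.log (2 * Nat.card (G ⧸ H₁)) := by
    rw [Real.log_mul two_ne_zero n₁.ne']
    linarith
  have hlt : (H₁ ⊓ H₂).index < 2 * H₁.index := by
    exact_mod_cast (Real.log_lt_log_iff n₂ (by positivity)).1 hlog
  rw [← AddSubgroup.relIndex_mul_index (inf_le_left : H₁ ⊓ H₂ ≤ H₁)] at hlt
  have hr : (H₁ ⊓ H₂).relIndex H₁ < 2 := lt_of_mul_lt_mul_right hlt (Nat.zero_le _)
  have hr0 : (H₁ ⊓ H₂).relIndex H₁ ≠ 0 := AddSubgroup.index_ne_zero_of_finite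
  have hone : (H₁ ⊓ H₂).relIndex H₁ = 1 := by omega
  exact (AddSubgroup.relIndex_eq_one.1 hone).trans inf_le_right

end Capacity

/-- with `δ₀ = (log 2)/3`, a channel is `δ₀`-determined by at most one
subgroup of `G`. -/
theorem stmt_11 {G : Type*} [AddCommGroup G] [Fintype G] {Y : Type*} [Fintype Y]
    (W : G → Y → ℝ) (hW : IsChannel W) (H₁ H₂ : AddSubgroup G)
    (h1 : DeterminedBy W H₁ (Real.log 2 / 3)) (h2 : DeterminedBy W H₂ (Real.log 2 / 3)) :
    H₁ = H₂ :=
  le_antisymm (le_of_determinedBy hW h1 h2) (le_of_determinedBy hW h2 h1)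

end
end
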